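/- Let C ⊆ ℝ^n be nonempty, convex, compact and symmetric (i.e., −x ∈ C whenever x ∈ C), and let (λ_j)_{j∈ℕ} be a real sequence with ∑_{j=0}^∞ |λ_j| < ∞. Then { ∑_{j=0}^∞ λ_j y_j : y_j ∈ C for all j } = (∑_{j=0}^∞ |λ_j|)·C, where all the series on the left converge absolutely. -/

import Mathlib

open scoped Pointwise BigOperators

theorem abs_smul_set_of_neg_mem {E : Type*} [AddCommGroup E] [Module ℝ E] {C : Set E}
    (hsym : ∀ x ∈ C, -x ∈ C) (a : ℝ) : |a| • C = a • C := by
  rcases abs_choice a with h | h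
  · rw [h]
  · rw [h]
    ext x
    constructor <;> rintro ⟨y, hy, rfl⟩ <;> exact ⟨-y, hsym y hy, by simp⟩

theorem Convex.zero_mem_of_neg_mem {E : Type*} [AddCommGroup E] [Module ℝ E] {C : Set E}
    (hconv : Convex ℝ C) (hne : C.Nonempty) (hsym : ∀ x ∈ C, -x ∈ C) : (0 : E) ∈ C := by
  obtain ⟨x, hx⟩ := hne
  simpa using hconv.midpoint_mem hx (hsym x hx)

theorem Convex.sum_mem_sum_smul {E ι : Type*} [AddCommGroup E] [Module ℝ E] {C : Set E}
    (hconv : Convex ℝ C) (hne : C.Nonempty) {w : ι → ℝ} (hw : ∀ i, 0 ≤ w i)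
    {z : ι → E} (hz : ∀ i, z i ∈ w i • C) (F : Finset ι) :
    ∑ i ∈ F, z i ∈ (∑ i ∈ F, w i) • C := by
  classical
  induction F using Finset.induction_on with
  | empty => simp [Set.zero_smul_set hne]
  | insert i F hi ih =>
    rw [Finset.sum_insert hi, Finset.sum_insert hi,
      hconv.add_smul (hw i) (Finset.sum_nonneg fun j _ => hw j)]
    exact Set.add_mem_add (hz i) ih

theorem Convex.smul_set_subset_smul_set_of_le {E : Type*} [AddCommGroup E] [Module ℝ E]
    {C : Set E} (hconv : Convex ℝ C) (h0 : (0 : E) ∈ C) {a b : ℝ} (ha : 0 ≤ a) (hab : a ≤ b) :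
    a • C ⊆ b • C := by
  intro x hx
  rw [← add_sub_cancel a b, hconv.add_smul ha (sub_nonneg.2 hab)]
  exact ⟨x, hx, 0, ⟨0, h0, smul_zero _⟩, add_zero x⟩

/-- For a nonempty, convex, compact, symmetric `C ⊆ ℝ^n` and an absolutely
summable real sequence `(λ_j)`, the infinite Minkowski sum
`{∑_{j=0}^∞ λ_j y_j : y_j ∈ C}` equals `(∑_{j=0}^∞ |λ_j|)·C`, and all the
defining series converge absolutely. -/
theorem infinite_minkowski_sum_of_symmetric_convex_compact (n : ℕ)
    (C : Set (EuclideanSpace ℝ (Fin n))) (hne : C.Nonempty)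
    (hconv : Convex ℝ C) (hcomp : IsCompact C) (hsym : ∀ x ∈ C, -x ∈ C)
    (l : ℕ → ℝ) (hl : Summable (fun j : ℕ => |l j|)) :
    (∀ y : ℕ → EuclideanSpace ℝ (Fin n), (∀ j : ℕ, y j ∈ C) →
        Summable (fun j : ℕ => ‖l j • y j‖)) ∧
    {s : EuclideanSpace ℝ (Fin n) |
        ∃ y : ℕ → EuclideanSpace ℝ (Fin n), (∀ j : ℕ, y j ∈ C) ∧
          HasSum (fun j : ℕ => l j • y j) s} = (∑' j : ℕ, |l j|) • C := by
  constructor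
  · intro y hy
    obtain ⟨R, hR⟩ := hcomp.isBounded.exists_norm_le
    refine Summable.of_nonneg_of_le (fun j => norm_nonneg _) (fun j => ?_) (hl.mul_right R)
    rw [norm_smul, Real.norm_eq_abs]
    exact mul_le_mul_of_nonneg_left (hR _ (hy j)) (abs_nonneg _)
  · apply Set.Subset.antisymm
    · rintro s ⟨y, hy, hs⟩
      refine (hcomp.smul (∑' j : ℕ, |l j|)).isClosed.mem_of_tendsto hs
        (Filter.Eventually.of_forall fun F => ?_)
      refine hconv.smul_set_subset_smul_set_of_le (hconv.zero_mem_of_neg_mem hne hsym)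
        (Finset.sum_nonneg fun j _ => abs_nonneg (l j))
        (hl.sum_le_tsum F fun j _ => abs_nonneg _) ?_
      refine hconv.sum_mem_sum_smul hne (fun j => abs_nonneg (l j)) (fun j => ?_) F
      rw [abs_smul_set_of_neg_mem hsym]
      exact Set.smul_mem_smul_set (hy j)
    · rintro _ ⟨c, hc, rfl⟩
      have h (j : ℕ) : ∃ y ∈ C, l j • y = |l j| • c := by
        rw [← Set.mem_smul_set, ← abs_smul_set_of_neg_mem hsym]
        exact Set.smul_mem_smul_set hc
      choose y hy hyc using h
      refine ⟨y, hy, ?_⟩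
      simp only [hyc]
      exact hl.hasSum.smul_const c
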